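/- arXiv:quant-ph/9808030 — 4 statements merged into one kernel-verified Lean document; each statement's English description precedes it below -/
import Mathlib

section
/- For the Pyramid vectors v_0,…,v_4: ⟨v_j, v_k⟩ = 0 whenever j − k ≡ ±2 (mod 5), and any three distinct vectors among v_0,…,v_4 are linearly independent, hence span ℝ³. -/
/-!
STATEMENT 3. For the Pyramid vectors v_0,…,v_4 ∈ ℝ³: ⟨v_j, v_k⟩ = 0 whenever
j − k ≡ ±2 (mod 5), and any three distinct v's are linearly independent, hence span ℝ³.
-/

noncomputable section

/-- Height of the pentagonal pyramid: `h = (1/2)√(1+√5)`. -/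
def pyrH : ℝ := (1 / 2) * Real.sqrt (1 + Real.sqrt 5)

/-- Normalization `N = 2/√(5+√5)`. -/
def pyrN : ℝ := 2 / Real.sqrt (5 + Real.sqrt 5)

/-- The Pyramid vectors `v_j = N (cos(2πj/5), sin(2πj/5), h) ∈ ℝ³`. -/
def vR (j : Fin 5) : Fin 3 → ℝ :=
  ![pyrN * Real.cos (2 * Real.pi * (j : ℕ) / 5),
    pyrN * Real.sin (2 * Real.pi * (j : ℕ) / 5),
    pyrN * pyrH]

theorem pyrH_pos : 0 < pyrH := by
  unfold pyrH; positivity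

theorem pyrN_pos : 0 < pyrN := by
  unfold pyrN; positivity

theorem pyrH_sq : pyrH ^ 2 = (1 + Real.sqrt 5) / 4 := by
  rw [pyrH, mul_pow, Real.sq_sqrt (by positivity)]
  ring

theorem sum_vR_mul_vR (j k : Fin 5) :
    ∑ i, vR j i * vR k i =
      pyrN ^ 2 * (Real.cos (2 * Real.pi * (j : ℕ) / 5 - 2 * Real.pi * (k : ℕ) / 5) + pyrH ^ 2) := by
  simp only [Fin.sum_univ_three, vR, Matrix.cons_val, Real.cos_sub]
  ring

theorem cos_four_pi_div_five : Real.cos (4 * Real.pi / 5) = -((1 + Real.sqrt 5) / 4) := by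
  rw [← Real.cos_pi_div_five, ← Real.cos_pi_sub]
  ring_nf

theorem cos_six_pi_div_five : Real.cos (6 * Real.pi / 5) = -((1 + Real.sqrt 5) / 4) := by
  rw [← Real.cos_pi_div_five, ← Real.cos_add_pi]
  ring_nf

theorem sum_vR_mul_vR_eq_zero {j k : Fin 5} (h : k = j + 2 ∨ k = j + 3) :
    ∑ i, vR j i * vR k i = 0 := by
  have hcos : Real.cos (2 * Real.pi * (j : ℕ) / 5 - 2 * Real.pi * (k : ℕ) / 5) =
      -((1 + Real.sqrt 5) / 4) := by
    have hjk : (k : ℕ) = j + 2 ∨ (k : ℕ) = j + 3 ∨ (j : ℕ) = k + 2 ∨ (j : ℕ) = k + 3 := by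
      revert j k; decide
    rcases hjk with e | e | e | e
    · rw [e, ← cos_four_pi_div_five, ← Real.cos_neg]; push_cast; ring_nf
    · rw [e, ← cos_six_pi_div_five, ← Real.cos_neg]; push_cast; ring_nf
    · rw [e, ← cos_four_pi_div_five]; push_cast; ring_nf
    · rw [e, ← cos_six_pi_div_five]; push_cast; ring_nf
  rw [sum_vR_mul_vR, hcos, pyrH_sq]
  ring

theorem sin_two_mul_add_sin_two_mul_sub (u w : ℝ) :
    Real.sin (2 * u) + Real.sin (2 * w) - Real.sin (2 * u + 2 * w) =
      4 * Real.sin u * Real.sin w * Real.sin (u + w) := by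
  simp only [Real.sin_add, Real.sin_two_mul, Real.cos_two_mul, Real.cos_sq']
  ring

theorem det_vR (j k l : Fin 5) :
    Matrix.det (Matrix.of ![vR j, vR k, vR l]) =
      4 * pyrN ^ 3 * pyrH * Real.sin (((k : ℕ) - (j : ℕ) : ℝ) * Real.pi / 5) *
        Real.sin (((l : ℕ) - (k : ℕ) : ℝ) * Real.pi / 5) *
        Real.sin (((l : ℕ) - (j : ℕ) : ℝ) * Real.pi / 5) := by
  have key := sin_two_mul_add_sin_two_mul_sub (((k : ℕ) - (j : ℕ) : ℝ) * Real.pi / 5)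
    (((l : ℕ) - (k : ℕ) : ℝ) * Real.pi / 5)
  have e₁ : 2 * (((k : ℕ) - (j : ℕ) : ℝ) * Real.pi / 5) =
      2 * Real.pi * (k : ℕ) / 5 - 2 * Real.pi * (j : ℕ) / 5 := by ring
  have e₂ : 2 * (((l : ℕ) - (k : ℕ) : ℝ) * Real.pi / 5) =
      2 * Real.pi * (l : ℕ) / 5 - 2 * Real.pi * (k : ℕ) / 5 := by ring
  have e₃ : ((k : ℕ) - (j : ℕ) : ℝ) * Real.pi / 5 + ((l : ℕ) - (k : ℕ) : ℝ) * Real.pi / 5 =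
      ((l : ℕ) - (j : ℕ) : ℝ) * Real.pi / 5 := by ring
  rw [e₃, e₁, e₂, sub_add_sub_cancel'] at key
  simp only [Real.sin_sub] at key
  simp only [Matrix.det_fin_three, Matrix.of_apply, vR, Matrix.cons_val]
  linear_combination pyrN ^ 3 * pyrH * key

theorem sin_sub_mul_pi_div_five_ne_zero {j k : Fin 5} (h : j ≠ k) :
    Real.sin (((k : ℕ) - (j : ℕ) : ℝ) * Real.pi / 5) ≠ 0 := by
  intro hs
  obtain ⟨n, hn⟩ := Real.sin_eq_zero_iff.mp hs
  have hR : (5 * n : ℝ) = (k : ℕ) - (j : ℕ) := by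
    apply mul_right_cancel₀ Real.pi_ne_zero
    linear_combination 5 * hn
  have hZ : 5 * n = ((k : ℕ) : ℤ) - ((j : ℕ) : ℤ) := by exact_mod_cast hR
  have := Fin.val_ne_of_ne h
  omega

theorem linearIndependent_vR {j k l : Fin 5} (hjk : j ≠ k) (hjl : j ≠ l) (hkl : k ≠ l) :
    LinearIndependent ℝ ![vR j, vR k, vR l] := by
  refine Matrix.linearIndependent_rows_of_det_ne_zero (A := Matrix.of ![vR j, vR k, vR l]) ?_
  rw [det_vR]
  have hN := pyrN_pos.ne'
  have hH := pyrH_pos.ne'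
  have h₁ := sin_sub_mul_pi_div_five_ne_zero hjk
  have h₂ := sin_sub_mul_pi_div_five_ne_zero hkl
  have h₃ := sin_sub_mul_pi_div_five_ne_zero hjl
  positivity

/-- **Nonadjacent Pyramid vectors are orthogonal, and any three distinct Pyramid vectors
are linearly independent and span ℝ³.** (In `Fin 5`, `k = j + 2 ∨ k = j + 3` expresses
`j − k ≡ ±2 (mod 5)`.) -/
theorem pyramid_vectors_orth_and_rank :
    (∀ j k : Fin 5, (k = j + 2 ∨ k = j + 3) → ∑ i, vR j i * vR k i = 0) ∧
    (∀ j k l : Fin 5, j ≠ k → j ≠ l → k ≠ l →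
      LinearIndependent ℝ ![vR j, vR k, vR l] ∧
      Submodule.span ℝ {vR j, vR k, vR l} = ⊤) := by
  refine ⟨fun j k h => sum_vR_mul_vR_eq_zero h, fun j k l hjk hjl hkl => ?_⟩
  have hli := linearIndependent_vR hjk hjl hkl
  refine ⟨hli, ?_⟩
  have hspan := hli.span_eq_top_of_card_eq_finrank' (by simp)
  rwa [Matrix.range_cons, Matrix.range_cons_cons_empty, Set.singleton_union] at hspan

end
end

section
/- The four Shifts states |0⟩⊗|1⟩⊗|+⟩, |1⟩⊗|+⟩⊗|0⟩, |+⟩⊗|0⟩⊗|1⟩, |−⟩⊗|−⟩⊗|−⟩ are pairwise orthogonal unit vectors in ℂ² ⊗ ℂ² ⊗ ℂ², and there is no nonzero product vector a ⊗ b ⊗ c (a, b, c ∈ ℂ² nonzero) orthogonal to all four; that is, Shifts is an unextendible product basis of ℂ² ⊗ ℂ² ⊗ ℂ². -/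
/-!
STATEMENT 5. The four **Shifts** states |0,1,+⟩, |1,+,0⟩, |+,0,1⟩, |−,−,−⟩ form an
unextendible product basis of ℂ² ⊗ ℂ² ⊗ ℂ².
-/

open ComplexConjugate

noncomputable section

/-- The standard hermitian inner product on `ι → ℂ` (antilinear in the first slot). -/
def ip {ι : Type*} [Fintype ι] (x y : ι → ℂ) : ℂ := ∑ i, conj (x i) * y i

/-- Tripartite product vector `a ⊗ b ⊗ c` on `Fin 2 × Fin 2 × Fin 2`. -/
def pv3 (a b c : Fin 2 → ℂ) : Fin 2 × Fin 2 × Fin 2 → ℂ :=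
  fun p => a p.1 * b p.2.1 * c p.2.2

/-- `|0⟩ ∈ ℂ²`. -/
def q0 : Fin 2 → ℂ := Pi.single 0 1
/-- `|1⟩ ∈ ℂ²`. -/
def q1 : Fin 2 → ℂ := Pi.single 1 1
/-- `|+⟩ = (|0⟩ + |1⟩)/√2`. -/
def qPlus : Fin 2 → ℂ := ((Real.sqrt 2 : ℂ))⁻¹ • (q0 + q1)
/-- `|−⟩ = (|0⟩ − |1⟩)/√2`. -/
def qMinus : Fin 2 → ℂ := ((Real.sqrt 2 : ℂ))⁻¹ • (q0 - q1)

/-- The Shifts states `|0,1,+⟩, |1,+,0⟩, |+,0,1⟩, |−,−,−⟩`. -/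
def shifts : Fin 4 → (Fin 2 × Fin 2 × Fin 2 → ℂ) :=
  ![pv3 q0 q1 qPlus, pv3 q1 qPlus q0, pv3 qPlus q0 q1, pv3 qMinus qMinus qMinus]

theorem ip_pv3 (a b c a' b' c' : Fin 2 → ℂ) :
    ip (pv3 a b c) (pv3 a' b' c') = ip a a' * ip b b' * ip c c' := by
  simp only [ip, pv3, Fintype.sum_prod_type, Fin.sum_univ_two, map_mul]
  ring

theorem inv_sqrt_two_mul_self : ((Real.sqrt 2 : ℂ))⁻¹ * ((Real.sqrt 2 : ℂ))⁻¹ = 1 / 2 := by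
  rw [← mul_inv, ← Complex.ofReal_mul, Real.mul_self_sqrt (by norm_num)]
  norm_num

theorem ip_q0 (a : Fin 2 → ℂ) : ip q0 a = a 0 := by
  simp [ip, q0]

theorem ip_q1 (a : Fin 2 → ℂ) : ip q1 a = a 1 := by
  simp [ip, q1]

theorem ip_qPlus (a : Fin 2 → ℂ) : ip qPlus a = ((Real.sqrt 2 : ℂ))⁻¹ * (a 0 + a 1) := by
  simp [ip, qPlus, q0, q1]
  ring

theorem ip_qMinus (a : Fin 2 → ℂ) : ip qMinus a = ((Real.sqrt 2 : ℂ))⁻¹ * (a 0 - a 1) := by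
  simp [ip, qMinus, q0, q1]
  ring

theorem ip_q0_q1 : ip q0 q1 = 0 := by
  simp [ip_q0, q1]

theorem ip_q1_q0 : ip q1 q0 = 0 := by
  simp [ip_q1, q0]

theorem ip_qPlus_self : ip qPlus qPlus = 1 := by
  rw [ip_qPlus]
  simp only [qPlus, q0, q1, Pi.smul_apply, Pi.add_apply, smul_eq_mul]
  simp
  linear_combination 2 * inv_sqrt_two_mul_self

theorem ip_qMinus_self : ip qMinus qMinus = 1 := by
  rw [ip_qMinus]
  simp only [qMinus, q0, q1, Pi.smul_apply, Pi.sub_apply, smul_eq_mul]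
  simp
  linear_combination 2 * inv_sqrt_two_mul_self

theorem ip_qPlus_qMinus : ip qPlus qMinus = 0 := by
  simp [ip_qPlus, qMinus, q0, q1]

theorem ip_qMinus_qPlus : ip qMinus qPlus = 0 := by
  simp [ip_qMinus, qPlus, q0, q1]

/-- A vector of `ℂ²` orthogonal to two of `|0⟩, |1⟩, |+⟩, |−⟩` vanishes. -/
theorem eq_zero_of_ip_eq_zero {a : Fin 2 → ℂ} {i j : Fin 4} (hij : i ≠ j)
    (hi : ip (![q0, q1, qPlus, qMinus] i) a = 0) (hj : ip (![q0, q1, qPlus, qMinus] j) a = 0) :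
    a = 0 := by
  have h : a 0 = 0 ∧ a 1 = 0 := by
    fin_cases i <;> fin_cases j <;>
      simp [ip_q0, ip_q1, ip_qPlus, ip_qMinus] at hij hi hj <;> grind
  ext k
  fin_cases k
  · exact h.1
  · exact h.2

/-- No nonzero product vector is orthogonal to all the Shifts states: two of the four
orthogonality relations would have to hold in the same tensor factor. -/
theorem not_orthogonal_shifts {a b c : Fin 2 → ℂ} (ha : a ≠ 0) (hb : b ≠ 0) (hc : c ≠ 0) :
    ¬ ∀ j, ip (shifts j) (pv3 a b c) = 0 := by
  intro h
  have h0 := h 0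
  have h1 := h 1
  have h2 := h 2
  have h3 := h 3
  simp only [shifts, Matrix.cons_val, ip_pv3, mul_eq_zero] at h0 h1 h2 h3
  have key : ∀ {x : Fin 2 → ℂ}, x ≠ 0 → ∀ i j : Fin 4, i ≠ j →
      ip (![q0, q1, qPlus, qMinus] i) x = 0 → ¬ ip (![q0, q1, qPlus, qMinus] j) x = 0 :=
    fun hx _ _ hij hi hj => hx (eq_zero_of_ip_eq_zero hij hi hj)
  have sep : ∀ {x : Fin 2 → ℂ}, x ≠ 0 →
      (ip q0 x = 0 → ¬ ip q1 x = 0) ∧ (ip q0 x = 0 → ¬ ip qPlus x = 0) ∧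
      (ip q0 x = 0 → ¬ ip qMinus x = 0) ∧ (ip q1 x = 0 → ¬ ip qPlus x = 0) ∧
      (ip q1 x = 0 → ¬ ip qMinus x = 0) ∧ (ip qPlus x = 0 → ¬ ip qMinus x = 0) :=
    fun hx => ⟨key hx 0 1 (by decide), key hx 0 2 (by decide), key hx 0 3 (by decide),
      key hx 1 2 (by decide), key hx 1 3 (by decide), key hx 2 3 (by decide)⟩
  have sa := sep ha
  have sb := sep hb
  have sc := sep hc
  clear key sep h
  grind

theorem span_shifts_ne_top : Submodule.span ℂ (Set.range shifts) ≠ ⊤ := by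
  intro h
  have hle := finrank_range_le_card (R := ℂ) shifts
  rw [Set.finrank, h, finrank_top, Module.finrank_fintype_fun_eq_card] at hle
  simp at hle

/-- **Shifts is a UPB of ℂ² ⊗ ℂ² ⊗ ℂ².** -/
theorem shifts_is_UPB :
    (∀ j, ip (shifts j) (shifts j) = 1) ∧
    (∀ j k, j ≠ k → ip (shifts j) (shifts k) = 0) ∧
    Submodule.span ℂ (Set.range shifts) ≠ ⊤ ∧
    ¬ ∃ (a b c : Fin 2 → ℂ), a ≠ 0 ∧ b ≠ 0 ∧ c ≠ 0 ∧
        ∀ j, ip (shifts j) (pv3 a b c) = 0 := by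
  refine ⟨fun j => ?_, fun j k hjk => ?_, span_shifts_ne_top, ?_⟩
  · fin_cases j <;>
      simp [shifts, ip_pv3, ip_qPlus_self, ip_qMinus_self, ip_q0, ip_q1] <;> simp [q0, q1]
  · fin_cases j <;> fin_cases k <;> first
      | exact absurd rfl hjk
      | simp [shifts, ip_pv3, ip_qPlus_qMinus, ip_qMinus_qPlus, ip_q0_q1, ip_q1_q0]
  · rintro ⟨a, b, c, ha, hb, hc, h⟩
    exact not_orthogonal_shifts ha hb hc h

end
end

section
/- Let S = {ψ_1,…,ψ_n} be an unextendible product basis in H = ⊗_{i=1}^m ℂ^{d_i}, with D = Π_{i=1}^m d_i. Then the complementary state ρ̄ = (1/(D−n))(I − Σ_{j=1}^n |ψ_j⟩⟨ψ_j|) is entangled: ρ̄ is not a convex combination of projectors onto product vectors of H. -/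
/-!
STATEMENT 6 (part of Theorem 1). For any UPB {ψ_1,…,ψ_n} in H = ⊗_{i=1}^m ℂ^{d_i}
of total dimension D, the complementary state
ρ̄ = (1/(D−n)) (I − Σ_j |ψ_j⟩⟨ψ_j|) is entangled (not separable).
-/

open ComplexConjugate

noncomputable section

/-- The product (tensor) vector `⊗_i φ_i` of local vectors. -/
def prodVec {m : ℕ} {d : Fin m → ℕ} (φ : ∀ i, Fin (d i) → ℂ) : (∀ i, Fin (d i)) → ℂ :=
  fun f => ∏ i, φ i (f i)

/-- The outer product `|x⟩⟨x|`. -/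
def outer {ι : Type*} (x : ι → ℂ) : Matrix ι ι ℂ :=
  Matrix.of fun f g => x f * conj (x g)

/-- A matrix on `⊗_i ℂ^{d_i}` is **separable** if it is a convex combination of projectors
onto (unit) product vectors. -/
def IsSep {m : ℕ} {d : Fin m → ℕ}
    (ρ : Matrix (∀ i, Fin (d i)) (∀ i, Fin (d i)) ℂ) : Prop :=
  ∃ (k : ℕ) (w : Fin k → ℝ) (χ : Fin k → ∀ i, Fin (d i) → ℂ),
    (∀ t, 0 ≤ w t) ∧ (∑ t, w t) = 1 ∧
    (∀ t i, χ t i ≠ 0) ∧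
    (∀ t, ip (prodVec (χ t)) (prodVec (χ t)) = 1) ∧
    ρ = ∑ t, (w t : ℂ) • outer (prodVec (χ t))

theorem ip_eq_dotProduct {ι : Type*} [Fintype ι] (x y : ι → ℂ) : ip x y = star x ⬝ᵥ y := rfl

theorem conj_ip {ι : Type*} [Fintype ι] (x y : ι → ℂ) : conj (ip x y) = ip y x := by
  simp [ip, map_sum, mul_comm]

theorem outer_mulVec {ι : Type*} [Fintype ι] (x y : ι → ℂ) :
    (outer x).mulVec y = ip x y • x := by
  ext f
  simp only [Matrix.mulVec, dotProduct, outer, Matrix.of_apply, ip, Pi.smul_apply, smul_eq_mul,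
    Finset.sum_mul]
  exact Finset.sum_congr rfl fun _ _ => by ring

theorem ip_outer_mulVec {ι : Type*} [Fintype ι] (x y : ι → ℂ) :
    ip x ((outer y).mulVec x) = (Complex.normSq (ip x y) : ℂ) := by
  rw [outer_mulVec, ip_eq_dotProduct x (ip y x • y), dotProduct_smul, ← ip_eq_dotProduct,
    ← Complex.mul_conj, conj_ip, smul_eq_mul, mul_comm]

/-- The complement of the projector onto an orthonormal family annihilates its members. -/
theorem one_sub_sum_outer_mulVec {ι κ : Type*} [Fintype ι] [DecidableEq ι] [Fintype κ]
    (ψ : κ → ι → ℂ) (hunit : ∀ j, ip (ψ j) (ψ j) = 1)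
    (horth : ∀ j k, j ≠ k → ip (ψ j) (ψ k) = 0) (j : κ) :
    ((1 : Matrix ι ι ℂ) - ∑ k, outer (ψ k)).mulVec (ψ j) = 0 := by
  rw [Matrix.sub_mulVec, Matrix.one_mulVec, Matrix.sum_mulVec, Finset.sum_eq_single j]
  · rw [outer_mulVec, hunit, one_smul, sub_self]
  · intro k _ hk
    rw [outer_mulVec, horth k j hk, zero_smul]
  · simp

/-- A vector annihilated by a nonnegative combination of projectors is orthogonal to every
vector of positive weight. -/
theorem ip_eq_zero_of_sum_outer_mulVec_eq_zero {ι κ : Type*} [Fintype ι] [Fintype κ]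
    (w : κ → ℝ) (hw : ∀ t, 0 ≤ w t) (v : κ → ι → ℂ) (x : ι → ℂ)
    (hx : (∑ t, (w t : ℂ) • outer (v t)).mulVec x = 0) {t : κ} (ht : w t ≠ 0) :
    ip x (v t) = 0 := by
  have hsum : ∑ s, w s * Complex.normSq (ip x (v s)) = 0 := by
    have h : ip x ((∑ t, (w t : ℂ) • outer (v t)).mulVec x) = 0 := by
      rw [hx, ip_eq_dotProduct, dotProduct_zero]
    rw [Matrix.sum_mulVec, ip_eq_dotProduct, dotProduct_sum] at h
    simp only [Matrix.smul_mulVec, dotProduct_smul, ← ip_eq_dotProduct, ip_outer_mulVec,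
      smul_eq_mul] at h
    exact_mod_cast h
  have h := (Finset.sum_eq_zero_iff_of_nonneg fun s _ =>
    mul_nonneg (hw s) (Complex.normSq_nonneg _)).1 hsum t (Finset.mem_univ t)
  exact Complex.normSq_eq_zero.1 ((mul_eq_zero.1 h).resolve_left ht)

/-- **The state complementary to a UPB is entangled.** Here the UPB is `ψ_j = ⊗_i φ_{i,j}`,
`D = ∏_i d_i` is the total dimension and the complementary state is
`ρ̄ = (D − n)⁻¹ (I − Σ_j |ψ_j⟩⟨ψ_j|)`. -/
theorem complementary_state_of_UPB_is_entangled {m n : ℕ} {d : Fin m → ℕ}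
    (φ : ∀ i : Fin m, Fin n → (Fin (d i) → ℂ))
    (hnz : ∀ i j, φ i j ≠ 0)
    (hunit : ∀ j, ip (prodVec fun i => φ i j) (prodVec fun i => φ i j) = 1)
    (horth : ∀ j k, j ≠ k →
      ip (prodVec fun i => φ i j) (prodVec fun i => φ i k) = 0)
    (hproper : Submodule.span ℂ (Set.range fun j => prodVec fun i => φ i j) ≠ ⊤)
    (hupb : ¬ ∃ χ : ∀ i, Fin (d i) → ℂ, (∀ i, χ i ≠ 0) ∧
        ∀ j, ip (prodVec fun i => φ i j) (prodVec χ) = 0) :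
    ¬ IsSep (((Fintype.card (∀ i, Fin (d i)) : ℂ) - (n : ℂ))⁻¹ •
        ((1 : Matrix (∀ i, Fin (d i)) (∀ i, Fin (d i)) ℂ)
          - ∑ j, outer (prodVec fun i => φ i j))) := by
  rintro ⟨k, w, χ, hw, hw1, hχ, -, hρ⟩
  obtain ⟨t, -, ht⟩ := Finset.exists_ne_zero_of_sum_ne_zero (hw1.trans_ne one_ne_zero)
  refine hupb ⟨χ t, hχ t, fun j =>
    ip_eq_zero_of_sum_outer_mulVec_eq_zero w hw (fun s => prodVec (χ s)) _ ?_ ht⟩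
  rw [← hρ, Matrix.smul_mulVec,
    one_sub_sum_outer_mulVec (fun j => prodVec fun i => φ i j) hunit horth j, smul_zero]

end
end

section
/- Let {ψ_1,…,ψ_n} be pairwise orthogonal unit product vectors in ℂ^{d₁} ⊗ ℂ^{d₂} with n < D = d₁d₂. Then the partial transpose of the complementary state ρ̄ = (1/(D−n))(I − Σ_{j=1}^n |ψ_j⟩⟨ψ_j|) is positive semidefinite. In particular, the complementary state of any bipartite UPB has positive partial transposition (PPT). -/
/-!
STATEMENT 7 (part of Theorem 1). For pairwise orthogonal unit product vectors
{ψ_1,…,ψ_n} in ℂ^{d₁} ⊗ ℂ^{d₂} with n < D = d₁d₂, the partial transpose of the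
complementary state ρ̄ = (1/(D−n))(I − Σ_j |ψ_j⟩⟨ψ_j|) is positive semidefinite.
-/

open ComplexConjugate
open scoped ComplexOrder

noncomputable section

/-- Bipartite product (Kronecker) vector `x ⊗ y`. -/
def pv2 {ι κ : Type*} (a : ι → ℂ) (b : κ → ℂ) : ι × κ → ℂ := fun p => a p.1 * b p.2

/-- Partial transpose with respect to the second tensor factor:
`ρ^{T₂}_{(i,j),(k,l)} = ρ_{(i,l),(k,j)}`. -/
def ptranspose {d₁ d₂ : ℕ}
    (ρ : Matrix (Fin d₁ × Fin d₂) (Fin d₁ × Fin d₂) ℂ) :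
    Matrix (Fin d₁ × Fin d₂) (Fin d₁ × Fin d₂) ℂ :=
  Matrix.of fun p q => ρ (p.1, q.2) (q.1, p.2)

theorem ip_pv2 {ι κ : Type*} [Fintype ι] [Fintype κ] (a c : ι → ℂ) (b d : κ → ℂ) :
    ip (pv2 a b) (pv2 c d) = ip a c * ip b d := by
  simp only [ip, pv2, Fintype.sum_prod_type, Finset.sum_mul_sum, map_mul]
  exact Finset.sum_congr rfl fun i _ => Finset.sum_congr rfl fun j _ => by ring

theorem ip_conj_conj {ι : Type*} [Fintype ι] (b d : ι → ℂ) :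
    ip (fun i => conj (b i)) (fun i => conj (d i)) = conj (ip b d) := by
  simp [ip, map_sum]

/-- One minus the projection onto the span of an orthonormal family is positive semidefinite. -/
theorem posSemidef_one_sub_sum_outer {ι m : Type*} [Fintype ι] [DecidableEq ι] [Fintype m]
    [DecidableEq m] (φ : m → ι → ℂ) (hφ : ∀ j k, ip (φ j) (φ k) = if j = k then 1 else 0) :
    ((1 : Matrix ι ι ℂ) - ∑ j, outer (φ j)).PosSemidef := by
  set V : Matrix ι m ℂ := Matrix.of fun p j => φ j p with hV
  have hVV : V.conjTranspose * V = 1 := by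
    ext j k
    simpa [hV, Matrix.mul_apply, Matrix.one_apply, ip] using hφ j k
  have hsum : ∑ j, outer (φ j) = V * V.conjTranspose := by
    ext p q
    simp [hV, Matrix.mul_apply, Matrix.sum_apply, outer]
  have hidem : V * V.conjTranspose * (V * V.conjTranspose) = V * V.conjTranspose := by
    rw [Matrix.mul_assoc, ← Matrix.mul_assoc V.conjTranspose, hVV, Matrix.one_mul]
  have hself : (1 - V * V.conjTranspose).conjTranspose * (1 - V * V.conjTranspose)
      = 1 - V * V.conjTranspose := by
    simp [Matrix.conjTranspose_mul, sub_mul, mul_sub, hidem]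
  rw [hsum, ← hself]
  exact Matrix.posSemidef_conjTranspose_mul_self _

/-- The partial transpose conjugates the second factor of a product projector. -/
theorem ptranspose_complement {d₁ d₂ n : ℕ} (c : ℂ) (x : Fin n → Fin d₁ → ℂ)
    (y : Fin n → Fin d₂ → ℂ) :
    ptranspose (c • ((1 : Matrix (Fin d₁ × Fin d₂) (Fin d₁ × Fin d₂) ℂ)
        - ∑ j, outer (pv2 (x j) (y j))))
      = c • (1 - ∑ j, outer (pv2 (x j) fun i => conj (y j i))) := by
  ext ⟨i, j⟩ ⟨k, l⟩
  have hone : (1 : Matrix (Fin d₁ × Fin d₂) (Fin d₁ × Fin d₂) ℂ) (i, l) (k, j)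
      = (1 : Matrix (Fin d₁ × Fin d₂) (Fin d₁ × Fin d₂) ℂ) (i, j) (k, l) := by
    simp [Matrix.one_apply, Prod.ext_iff, eq_comm (a := l)]
  simp only [ptranspose, Matrix.of_apply, Matrix.smul_apply, Matrix.sub_apply, hone,
    Matrix.sum_apply, outer, pv2, map_mul, Complex.conj_conj]
  congr 2
  exact Finset.sum_congr rfl fun m _ => by ring

/-- **The complementary state of a bipartite orthogonal product basis has positive
partial transpose (PPT).** -/
theorem complementary_state_is_PPT {d₁ d₂ n : ℕ}
    (x : Fin n → Fin d₁ → ℂ) (y : Fin n → Fin d₂ → ℂ)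
    (hx : ∀ j, x j ≠ 0) (hy : ∀ j, y j ≠ 0)
    (hunit : ∀ j, ip (pv2 (x j) (y j)) (pv2 (x j) (y j)) = 1)
    (horth : ∀ j k, j ≠ k → ip (pv2 (x j) (y j)) (pv2 (x k) (y k)) = 0)
    (hn : n < d₁ * d₂) :
    (ptranspose (((d₁ * d₂ : ℂ) - (n : ℂ))⁻¹ •
        ((1 : Matrix (Fin d₁ × Fin d₂) (Fin d₁ × Fin d₂) ℂ)
          - ∑ j, outer (pv2 (x j) (y j))))).PosSemidef := by
  rw [ptranspose_complement]
  refine Matrix.PosSemidef.smul (posSemidef_one_sub_sum_outer _ fun j k => ?_) ?_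
  · rw [ip_pv2, ip_conj_conj]
    split_ifs with h
    · subst h
      have hreal : conj (ip (y j) (y j)) = ip (y j) (y j) := by
        simp [ip, map_sum, mul_comm]
      rw [hreal, ← ip_pv2, hunit]
    · have h0 := horth j k h
      rw [ip_pv2, mul_eq_zero] at h0
      rcases h0 with h0 | h0 <;> simp [h0]
  · have hle : (n : ℂ) ≤ (d₁ * d₂ : ℂ) := by exact_mod_cast hn.le
    exact inv_nonneg.mpr (sub_nonneg.mpr hle)

end
end
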